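/- arXiv:1703.08385 — 2 statements merged into one kernel-verified Lean document; each statement's English description precedes it below -/
import Mathlib

section
/- Suppose the Borel probability measure α on Ω is C*-Gibbs for a Hölder potential U. Let n, m ≥ 1, let C = {z ∈ Ω : z_j = a_j for −n ≤ j ≤ m} be a cylinder, and let r be an integer with 0 < r ≤ n. Then there exists a homeomorphism φ from C onto τ^{−r}(C) = {z ∈ Ω : z_{j+r} = a_j for −n ≤ j ≤ m} such that φ(z) ∼ z for every z ∈ C (φ changes only finitely many coordinates of each point) and for every continuous f : Ω → ℂ, ∫_C e^{−V(z, φ(z))} f(φ(z)) dα(z) = ∫_{τ^{−r}(C)} f dα. -/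
open MeasureTheory Filter
open scoped ENNReal

noncomputable section

/-- The two-sided full shift space `Ω = {1,…,d}^ℤ` (alphabet `Fin d`). -/
abbrev Omega (d : ℕ) : Type := ℤ → Fin d

/-- The shift map `τ`, `(τ x) j = x (j+1)`. -/
def tau (d : ℕ) (x : Omega d) : Omega d := fun j => x (j + 1)

/-- The `k`-th iterate of the shift (`k ∈ ℤ`): `(τ^k x) j = x (j + k)`. -/
def tauZ (d : ℕ) (k : ℤ) (x : Omega d) : Omega d := fun j => x (j + k)

/-- `x` and `y` are homoclinic: they differ in only finitely many coordinates. -/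
def Homoclinic (d : ℕ) (x y : Omega d) : Prop := Set.Finite {j : ℤ | x j ≠ y j}

/-- `U` is Hölder continuous for the standard metric `dist x y = 2^{-N}`:
there are `C > 0` and `0 < θ < 1` with `|U x - U y| ≤ C θ^N` whenever
`x` and `y` agree on all coordinates `|j| ≤ N`. -/
def HolderPotential (d : ℕ) (U : Omega d → ℝ) : Prop :=
  ∃ C θ : ℝ, 0 < C ∧ 0 < θ ∧ θ < 1 ∧
    ∀ (x y : Omega d) (N : ℕ), (∀ j : ℤ, |j| ≤ (N : ℤ) → x j = y j) →
      |U x - U y| ≤ C * θ ^ N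

/-- `U` depends on only finitely many coordinates. -/
def FiniteRange (d : ℕ) (U : Omega d → ℝ) : Prop :=
  ∃ s : Finset ℤ, ∀ x y : Omega d, (∀ j ∈ s, x j = y j) → U x = U y

/-- `V(x,y) = ∑_{k ∈ ℤ} (U(τ^k x) - U(τ^k y))`. -/
def Vfun (d : ℕ) (U : Omega d → ℝ) (x y : Omega d) : ℝ :=
  ∑' k : ℤ, (U (tauZ d k x) - U (tauZ d k y))

/-- The cylinder `{z : z_j = a_j for -n ≤ j ≤ m}`. -/
def cyl (d : ℕ) (n m : ℕ) (a : ℤ → Fin d) : Set (Omega d) :=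
  {z | ∀ j : ℤ, -(n : ℤ) ≤ j → j ≤ (m : ℤ) → z j = a j}

/-- The conjugating homeomorphism with window `-n ≤ j ≤ m` and target word `b`:
it replaces the coordinates in the window by those of `b` and keeps the rest. -/
def conjMap (d : ℕ) (n m : ℕ) (b : ℤ → Fin d) (z : Omega d) : Omega d :=
  fun j => if -(n : ℤ) ≤ j ∧ j ≤ (m : ℤ) then b j else z j

/-- `α` is a C*-Gibbs measure for `U` (at inverse temperature `β = 1`):
for every symmetric conjugating homeomorphism `(O, φ)` and every continuous
`f : Ω → ℂ`, `∫_O e^{-V(z, φ z)} f(φ z) dα = ∫_{φ(O)} f dα`. -/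
def CStarGibbs (d : ℕ) (U : Omega d → ℝ) (α : Measure (Omega d)) : Prop :=
  ∀ n : ℕ, 1 ≤ n → ∀ (a b : ℤ → Fin d) (f : Omega d → ℂ), Continuous f →
    ∫ z in cyl d n n a,
        (Real.exp (-(Vfun d U z (conjMap d n n b z))) : ℂ) * f (conjMap d n n b z) ∂α
      = ∫ z in cyl d n n b, f z ∂α

/-- `α` is a quasi-C*-Gibbs measure for `U`: there are constants `d₁, d₂ > 0`
such that for every conjugating homeomorphism `(O, φ)` and every nonnegative
continuous `f : Ω → ℝ`,
`d₁ ∫_O e^{-V(z,φz)} f(φ z) dα ≤ ∫_{φ(O)} f dα ≤ d₂ ∫_O e^{-V(z,φz)} f(φ z) dα`. -/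
def QuasiCStarGibbs (d : ℕ) (U : Omega d → ℝ) (α : Measure (Omega d)) : Prop :=
  ∃ d₁ d₂ : ℝ, 0 < d₁ ∧ 0 < d₂ ∧
    ∀ (n m : ℕ), 1 ≤ n → 1 ≤ m → ∀ (a b : ℤ → Fin d) (f : Omega d → ℝ),
      Continuous f → (∀ z, 0 ≤ f z) →
      (d₁ * ∫ z in cyl d n m a,
          Real.exp (-(Vfun d U z (conjMap d n m b z))) * f (conjMap d n m b z) ∂α
        ≤ ∫ z in cyl d n m b, f z ∂α) ∧
      (∫ z in cyl d n m b, f z ∂α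
        ≤ d₂ * ∫ z in cyl d n m a,
            Real.exp (-(Vfun d U z (conjMap d n m b z))) * f (conjMap d n m b z) ∂α)

/-- The future cylinder `{z : z_k = a_k for 1 ≤ k ≤ s}`. -/
def futureCyl (d : ℕ) (s : ℕ) (a : ℕ → Fin d) : Set (Omega d) :=
  {z | ∀ k : ℕ, 1 ≤ k → k ≤ s → z (k : ℤ) = a k}

/-- The Birkhoff sum `∑_{k=0}^{s-1} U(τ^k x)`. -/
def birkhoff (d : ℕ) (U : Omega d → ℝ) (s : ℕ) (x : Omega d) : ℝ :=
  ∑ k ∈ Finset.range s, U (tauZ d (k : ℤ) x)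

/-- `ρ` is the equilibrium (Gibbs) probability for `U`: it is `τ`-invariant and
satisfies Bowen's inequalities. -/
def IsEquilibrium (d : ℕ) (U : Omega d → ℝ) (ρ : Measure (Omega d)) : Prop :=
  Measure.map (tau d) ρ = ρ ∧
  ∃ C₁ C₂ P : ℝ, 0 < C₁ ∧ 0 < C₂ ∧
    ∀ s : ℕ, 1 ≤ s → ∀ (a : ℕ → Fin d) (x : Omega d),
      (∀ k : ℕ, 1 ≤ k → k ≤ s → x (k : ℤ) = a k) →
      C₁ ≤ (ρ (futureCyl d s a)).toReal * Real.exp (P * s - birkhoff d U s x) ∧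
      (ρ (futureCyl d s a)).toReal * Real.exp (P * s - birkhoff d U s x) ≤ C₂

/-- The point whose coordinates `1, 2, 3, …` are `j, x₁, x₂, …`. -/
def prepend (d : ℕ) (j : Fin d) (x : Omega d) : Omega d :=
  fun k => if k = 1 then j else x (k - 1)

/-- A potential depending on the coordinates `x₁, …, x_r` is normalized if
`∑_{j=1}^d exp(f(j, x₁, …, x_{r-1})) = 1` for all choices of `x₁, …, x_{r-1}`. -/
def Normalized (d : ℕ) (U : Omega d → ℝ) : Prop :=
  ∀ x : Omega d, ∑ j : Fin d, Real.exp (U (prepend d j x)) = 1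

theorem HolderPotential.continuous {d : ℕ} {U : Omega d → ℝ} (hU : HolderPotential d U) :
    Continuous U := by
  obtain ⟨C, θ, hC, hθ, hθ1, h⟩ := hU
  rw [Metric.continuous_iff']
  intro x ε hε
  obtain ⟨N, hN⟩ := exists_pow_lt_of_lt_one (div_pos hε hC) hθ1
  have hev : ∀ᶠ y in nhds x, ∀ j ∈ Finset.Icc (-(N : ℤ)) N, y j = x j := by
    rw [Filter.eventually_all_finset]
    intro j _
    exact (continuous_apply j).continuousAt ((isOpen_discrete {x j}).mem_nhds rfl)
  filter_upwards [hev] with y hy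
  rw [Real.dist_eq]
  calc |U y - U x| ≤ C * θ ^ N :=
        h y x N fun j hj => hy j (Finset.mem_Icc.mpr (abs_le.mp hj))
    _ < C * (ε / C) := by gcongr
    _ = ε := by field_simp

theorem continuous_tauZ (d : ℕ) (k : ℤ) : Continuous (tauZ d k) :=
  continuous_pi fun j => continuous_apply (j + k)

theorem summable_pow_natAbs {θ : ℝ} (h₀ : 0 ≤ θ) (h₁ : θ < 1) :
    Summable fun k : ℤ => θ ^ k.natAbs :=
  Summable.of_nat_of_neg (by simpa using summable_geometric_of_lt_one h₀ h₁)
    (by simpa using summable_geometric_of_lt_one h₀ h₁)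

/-- A uniform bound for the terms of the series `V`, for pairs of points which agree outside
the window `|j| ≤ N`. -/
theorem HolderPotential.exists_summable_bound {d : ℕ} {U : Omega d → ℝ}
    (hU : HolderPotential d U) (N : ℕ) :
    ∃ u : ℤ → ℝ, Summable u ∧ ∀ (k : ℤ) (x y : Omega d),
      (∀ j : ℤ, (N : ℤ) < |j| → x j = y j) → |U (tauZ d k x) - U (tauZ d k y)| ≤ u k := by
  obtain ⟨B, hB⟩ := isCompact_univ.exists_bound_of_continuousOn hU.continuous.continuousOn
  obtain ⟨C, θ, hC, hθ, hθ1, h⟩ := hU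
  refine ⟨fun k => (2 * |B| + C) / θ ^ (N + 1) * θ ^ k.natAbs,
    (summable_pow_natAbs hθ.le hθ1).mul_left _, fun k x y hxy => ?_⟩
  dsimp only
  rw [div_mul_eq_mul_div, le_div_iff₀ (by positivity)]
  rcases le_or_gt (N + 1) k.natAbs with hk | hk
  · have hM := h (tauZ d k x) (tauZ d k y) (k.natAbs - (N + 1)) fun j hj => hxy _ (by grind)
    calc _ ≤ C * θ ^ (k.natAbs - (N + 1)) * θ ^ (N + 1) := by gcongr
      _ = C * θ ^ k.natAbs := by rw [mul_assoc, ← pow_add, Nat.sub_add_cancel hk]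
      _ ≤ _ := by gcongr; linarith [abs_nonneg B]
  · have h2 : |U (tauZ d k x) - U (tauZ d k y)| ≤ 2 * |B| := by
      have h3 := hB (tauZ d k x) trivial
      have h4 := hB (tauZ d k y) trivial
      rw [Real.norm_eq_abs] at h3 h4
      linarith [abs_sub (U (tauZ d k x)) (U (tauZ d k y)), le_abs_self B]
    calc _ ≤ 2 * |B| * θ ^ (N + 1) := by gcongr
      _ ≤ (2 * |B| + C) * θ ^ k.natAbs :=
        mul_le_mul (by linarith) (pow_le_pow_of_le_one hθ.le hθ1.le hk.le) (by positivity)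
          (by positivity)

theorem HolderPotential.continuous_Vfun {d : ℕ} {U : Omega d → ℝ} (hU : HolderPotential d U)
    {φ : Omega d → Omega d} (hφ : Continuous φ) (N : ℕ)
    (hN : ∀ z (j : ℤ), (N : ℤ) < |j| → z j = φ z j) :
    Continuous fun z => Vfun d U z (φ z) := by
  obtain ⟨u, hu, hle⟩ := hU.exists_summable_bound N
  refine continuous_tsum (fun k => ?_) hu fun k z => hle k z (φ z) (hN z)
  exact (hU.continuous.comp (continuous_tauZ d k)).sub
    (hU.continuous.comp ((continuous_tauZ d k).comp hφ))

theorem isClopen_cyl (d n m : ℕ) (a : ℤ → Fin d) : IsClopen (cyl d n m a) := by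
  have h : cyl d n m a = ⋂ j ∈ Finset.Icc (-(n : ℤ)) m, (fun z : Omega d => z j) ⁻¹' {a j} := by
    ext z
    simp [cyl]
  rw [h]
  exact isClopen_biInter_finset fun j _ => (isClopen_discrete {a j}).preimage (continuous_apply j)

/-- The extension of a word on the window `|j| ≤ N` by a constant letter. -/
def extendWord {d : ℕ} (N : ℕ) (e : Fin d) (w : Finset.Icc (-(N : ℤ)) N → Fin d) : ℤ → Fin d :=
  fun j => if h : j ∈ Finset.Icc (-(N : ℤ)) N then w ⟨j, h⟩ else e

theorem mem_cyl_extendWord {d N : ℕ} {e : Fin d} {w : Finset.Icc (-(N : ℤ)) N → Fin d}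
    {z : Omega d} : z ∈ cyl d N N (extendWord N e w) ↔ (fun j => z j.1) = w := by
  constructor
  · intro h
    funext ⟨j, hj⟩
    obtain ⟨h₁, h₂⟩ := Finset.mem_Icc.mp hj
    simpa [extendWord, h₁, h₂] using h j h₁ h₂
  · rintro rfl j h₁ h₂
    simp [extendWord, h₁, h₂]

/-- The integral over `Ω` splits over the images of the cylinders of window `|j| ≤ N` under a
coordinate permutation. -/
theorem integral_eq_sum_cyl {d : ℕ} (α : Measure (Omega d)) [IsFiniteMeasure α] (N : ℕ)
    (e : Fin d) {g : Omega d → ℂ} (hg : Continuous g) (ψ : Omega d → Omega d)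
    (hψ : Continuous ψ) :
    ∫ z, g z ∂α = ∑ w, ∫ z in ψ ⁻¹' cyl d N N (extendWord N e w), g z ∂α := by
  have hU : ⋃ w, ψ ⁻¹' cyl d N N (extendWord N e w) = Set.univ :=
    Set.eq_univ_of_forall fun z => Set.mem_iUnion.mpr ⟨_, mem_cyl_extendWord.mpr rfl⟩
  have hint : Integrable g α := hg.integrable_of_hasCompactSupport (.of_compactSpace g)
  rw [← setIntegral_univ, ← hU, integral_iUnion_fintype]
  · exact fun w => ((isClopen_cyl d N N _).preimage hψ).isClosed.measurableSet
  · refine fun w w' hne => Set.disjoint_left.mpr fun z hz hz' => hne ?_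
    exact (mem_cyl_extendWord.mp hz).symm.trans (mem_cyl_extendWord.mp hz')
  · exact fun w => hint.integrableOn

theorem continuous_comp_perm {d : ℕ} (σ : ℤ → ℤ) :
    Continuous fun z : Omega d => (z ∘ σ : Omega d) :=
  continuous_pi fun j => continuous_apply (σ j)

/-- The Gibbs property for a permutation of finitely many coordinates, on the whole space. -/
theorem CStarGibbs.integral_comp_perm {d : ℕ} {U : Omega d → ℝ} (hU : HolderPotential d U)
    {α : Measure (Omega d)} [IsFiniteMeasure α] (hGibbs : CStarGibbs d U α) (e : Fin d)
    (σ : Equiv.Perm ℤ) {N : ℕ} (hN : 1 ≤ N) (hσ : ∀ j : ℤ, (N : ℤ) < |j| → σ j = j)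
    {f : Omega d → ℂ} (hf : Continuous f) :
    ∫ z, (Real.exp (-(Vfun d U z (z ∘ σ))) : ℂ) * f (z ∘ σ) ∂α = ∫ z, f z ∂α := by
  have hmem : ∀ j : ℤ, |σ j| ≤ N ↔ |j| ≤ N := by
    intro j
    constructor
    · intro h
      by_contra hj
      rw [hσ j (not_le.mp hj)] at h
      exact hj h
    · intro h
      by_contra hj
      exact hj ((σ.injective (hσ (σ j) (not_le.mp hj))).symm ▸ h)
  have hcont : Continuous fun z : Omega d =>
      (Real.exp (-(Vfun d U z (z ∘ σ))) : ℂ) * f (z ∘ σ) := by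
    have hV := hU.continuous_Vfun (continuous_comp_perm σ) N
      fun z j hj => (congrArg z (hσ j hj)).symm
    exact (Complex.continuous_ofReal.comp (Real.continuous_exp.comp hV.neg)).mul
      (hf.comp (continuous_comp_perm σ))
  rw [integral_eq_sum_cyl α N e hcont id continuous_id,
    integral_eq_sum_cyl α N e hf (fun z => z ∘ σ.symm) (continuous_comp_perm σ.symm)]
  refine Finset.sum_congr rfl fun w _ => ?_
  set c := extendWord N e w
  have hpre : (fun z : Omega d => (z ∘ σ.symm : Omega d)) ⁻¹' cyl d N N c
      = cyl d N N (c ∘ σ) := by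
    ext z
    constructor
    · intro h j h₁ h₂
      have hj := abs_le.mp ((hmem j).mpr (abs_le.mpr ⟨h₁, h₂⟩))
      simpa using h (σ j) hj.1 hj.2
    · intro h j h₁ h₂
      have hj := abs_le.mp ((hmem (σ.symm j)).mp (by simpa using abs_le.mpr ⟨h₁, h₂⟩))
      simpa using h (σ.symm j) hj.1 hj.2
  rw [hpre, ← hGibbs N hN c (c ∘ σ) f hf, Set.preimage_id]
  refine setIntegral_congr_fun (isClopen_cyl d N N c).isClosed.measurableSet fun z hz => ?_
  have hconj : (z ∘ σ : Omega d) = conjMap d N N (c ∘ σ) z := by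
    funext j
    by_cases hj : -(N : ℤ) ≤ j ∧ j ≤ N
    · have hj' := abs_le.mp ((hmem j).mpr (abs_le.mpr hj))
      simpa [conjMap, hj] using hz (σ j) hj'.1 hj'.2
    · simp [conjMap, hj, hσ j (not_le.mp fun h => hj (abs_le.mp h))]
  simp only [hconj]

/-- The cyclic rotation by `r` of the integer interval `[-n, m + r]`. -/
def windowRotation (n m r : ℕ) : Equiv.Perm ℤ where
  toFun j := if -(n : ℤ) + r ≤ j ∧ j ≤ m + r then j - r
    else if -(n : ℤ) ≤ j ∧ j < -n + r then j + m + n + 1 else j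
  invFun j := if -(n : ℤ) ≤ j ∧ j ≤ m then j + r
    else if (m : ℤ) < j ∧ j ≤ m + r then j - m - n - 1 else j
  left_inv j := by grind
  right_inv j := by grind

theorem comp_windowRotation_mem_iff {d n m r : ℕ} {a : ℤ → Fin d} {z : Omega d} :
    z ∘ windowRotation n m r ∈ tauZ d (r : ℤ) ⁻¹' cyl d n m a ↔ z ∈ cyl d n m a := by
  refine forall₃_congr fun j h₁ h₂ => ?_
  have h : windowRotation n m r (j + r) = j := by
    simp only [windowRotation, Equiv.coe_fn_mk]
    grind
  simp [tauZ, h]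

theorem windowRotation_of_lt_abs {n m r : ℕ} {j : ℤ} (hj : ((n + m + r : ℕ) : ℤ) < |j|) :
    windowRotation n m r j = j := by
  simp only [windowRotation, Equiv.coe_fn_mk]
  grind

/-- for a C*-Gibbs `α`, a cylinder `C` with window `-n ≤ j ≤ m`
and `0 < r ≤ n`, there is a homeomorphism `φ` from `C` onto `τ^{-r}(C)`,
changing only finitely many coordinates of each point, with
`∫_C e^{-V(z, φ z)} f(φ z) dα = ∫_{τ^{-r}(C)} f dα` for all continuous `f`. -/
theorem cstarGibbs_shift_conjugating (d : ℕ) (hd : 2 ≤ d) (U : Omega d → ℝ)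
    (hU : HolderPotential d U) (α : Measure (Omega d)) (hα : IsProbabilityMeasure α)
    (hGibbs : CStarGibbs d U α)
    (n m : ℕ) (hn : 1 ≤ n) (hm : 1 ≤ m) (a : ℤ → Fin d)
    (r : ℕ) (hr : 0 < r) (hrn : r ≤ n) :
    ∃ φ : Omega d → Omega d,
      ContinuousOn φ (cyl d n m a) ∧
      Set.BijOn φ (cyl d n m a) (tauZ d (r : ℤ) ⁻¹' cyl d n m a) ∧
      (∀ z ∈ cyl d n m a, Homoclinic d z (φ z)) ∧
      ∀ f : Omega d → ℂ, Continuous f →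
        ∫ z in cyl d n m a, (Real.exp (-(Vfun d U z (φ z))) : ℂ) * f (φ z) ∂α
          = ∫ z in tauZ d (r : ℤ) ⁻¹' cyl d n m a, f z ∂α := by
  set σ := windowRotation n m r
  have hσ : ∀ j : ℤ, ((n + m + r : ℕ) : ℤ) < |j| → σ j = j := fun j => windowRotation_of_lt_abs
  refine ⟨fun z => z ∘ σ, (continuous_comp_perm σ).continuousOn, ⟨?_, ?_, ?_⟩, ?_, ?_⟩
  · exact fun z hz => comp_windowRotation_mem_iff.mpr hz
  · exact (σ.surjective.injective_comp_right).injOn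
  · intro y hy
    have hinv : (y ∘ σ.symm) ∘ σ = y := by simp [Function.comp_assoc]
    exact ⟨y ∘ σ.symm, comp_windowRotation_mem_iff.mp (hinv.symm ▸ hy), hinv⟩
  · refine fun z _ => (Set.finite_Icc (-((n + m + r : ℕ) : ℤ)) (n + m + r : ℕ)).subset ?_
    intro j hj
    by_contra hjN
    exact hj (congrArg z (hσ j (not_le.mp fun h => hjN (abs_le.mp h)))).symm
  · intro f hf
    have hD := (isClopen_cyl d n m a).preimage (continuous_tauZ d r)
    rw [← integral_indicator (isClopen_cyl d n m a).isClosed.measurableSet,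
      ← integral_indicator hD.isClosed.measurableSet,
      ← hGibbs.integral_comp_perm hU ⟨0, by omega⟩ σ (by omega) hσ (hD.continuous_indicator hf)]
    congr 1
    funext z
    by_cases hz : z ∈ cyl d n m a
    · rw [Set.indicator_of_mem hz, Set.indicator_of_mem (comp_windowRotation_mem_iff.mpr hz)]
    · rw [Set.indicator_of_notMem hz,
        Set.indicator_of_notMem (mt comp_windowRotation_mem_iff.mp hz), mul_zero]
end
end

section
/- Let r ≥ 1, f : {1,…,d}^r → ℝ, and let U(x) = f(x₁,…,x_r) be a normalized potential depending only on the coordinates x₁,…,x_r. If the Borel probability measure α on Ω is quasi-C*-Gibbs for U, then there exists a constant c₁ > 0 such that for every s ≥ 1, every word (a₁,…,a_s) ∈ {1,…,d}^s and every x ∈ Ω with x_k = a_k for 1 ≤ k ≤ s, c₁ ≤ exp(−∑_{k=0}^{s−1} U(τ^k x)) · α({z ∈ Ω : z_k = a_k for 1 ≤ k ≤ s}). In particular, every cylinder set has positive α-measure. -/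
open MeasureTheory Filter
open scoped ENNReal

noncomputable section

/-- The point whose coordinates `1, 2, 3, …` are the letters of `w` followed by `x₁, x₂, …`. -/
def prependWord (d : ℕ) : (n : ℕ) → (Fin n → Fin d) → Omega d → Omega d
  | 0, _, x => x
  | n + 1, w, x => prepend d (w 0) (prependWord d n (Fin.tail w) x)

lemma exists_prependWord_eq (d : ℕ) (x : Omega d) (n : ℕ) (z : Omega d) :
    ∃ w : Fin n → Fin d, ∀ k : ℤ, 1 ≤ k → k ≤ n → prependWord d n w x k = z k := by
  induction n generalizing z with
  | zero => exact ⟨Fin.elim0, fun k h1 h2 => by push_cast at h2; omega⟩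
  | succ n ih =>
    obtain ⟨w, hw⟩ := ih (tauZ d 1 z)
    refine ⟨Fin.cons (z 1) w, fun k h1 h2 => ?_⟩
    simp only [prependWord, prepend, Fin.cons_zero, Fin.tail_cons]
    split_ifs with hk
    · rw [hk]
    · push_cast at h2
      rw [hw (k - 1) (by omega) (by omega), tauZ, sub_add_cancel]

section FiniteRange

variable {d r : ℕ} {f : (Fin r → Fin d) → ℝ} {U : Omega d → ℝ}

lemma apply_tauZ_congr (hUf : ∀ x : Omega d, U x = f (fun i => x (((i : ℕ) : ℤ) + 1)))
    {x y : Omega d} {k : ℤ} (hxy : ∀ j : ℤ, k + 1 ≤ j → j ≤ k + r → x j = y j) :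
    U (tauZ d k x) = U (tauZ d k y) := by
  rw [hUf, hUf]
  congr 1
  funext i
  have := i.isLt
  exact hxy _ (by omega) (by omega)

lemma birkhoff_succ_prepend (hUf : ∀ x : Omega d, U x = f (fun i => x (((i : ℕ) : ℤ) + 1)))
    (n : ℕ) (j : Fin d) (x : Omega d) :
    birkhoff d U (n + 1) (prepend d j x) = U (prepend d j x) + birkhoff d U n x := by
  rw [birkhoff, Finset.sum_range_succ', add_comm]
  congr 1
  · congr 1
    funext i
    simp [tauZ]
  · refine Finset.sum_congr rfl fun k _ => ?_
    rw [hUf, hUf]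
    congr 1
    funext i
    simp only [tauZ, prepend]
    rw [if_neg (by push_cast; omega)]
    congr 1
    push_cast
    ring

lemma sum_exp_birkhoff_prependWord
    (hUf : ∀ x : Omega d, U x = f (fun i => x (((i : ℕ) : ℤ) + 1)))
    (hnorm : Normalized d U) (n : ℕ) (x : Omega d) :
    ∑ w : Fin n → Fin d, Real.exp (birkhoff d U n (prependWord d n w x)) = 1 := by
  induction n with
  | zero => simp [birkhoff]
  | succ n ih =>
    rw [← (Fin.consEquiv fun _ : Fin (n + 1) => Fin d).sum_comp, Fintype.sum_prod_type,
      Finset.sum_comm, ← ih]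
    refine Finset.sum_congr rfl fun w _ => ?_
    have hcons : ∀ j : Fin d,
        Real.exp (birkhoff d U (n + 1) (prependWord d (n + 1) (Fin.cons j w) x)) =
          Real.exp (U (prepend d j (prependWord d n w x))) *
            Real.exp (birkhoff d U n (prependWord d n w x)) := fun j => by
      rw [← Real.exp_add, ← birkhoff_succ_prepend hUf, prependWord, Fin.cons_zero, Fin.tail_cons]
    refine (Finset.sum_congr rfl fun j _ => hcons j).trans ?_
    rw [← Finset.sum_mul, hnorm, one_mul]

lemma birkhoff_tauZ (n : ℕ) (a : ℤ) (x : Omega d) :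
    birkhoff d U n (tauZ d a x) = ∑ k ∈ Finset.Ico a (a + n), U (tauZ d k x) := by
  refine Finset.sum_nbij' (fun k => (k : ℤ) + a) (fun k => (k - a).toNat) ?_ ?_ ?_ ?_ ?_
  · intro k hk
    simp at hk ⊢
    omega
  · intro k hk
    simp at hk ⊢
    omega
  · intro k _
    simp
  · intro k hk
    simp at hk ⊢
    omega
  · intro k _
    congr 1
    funext j
    simp only [tauZ]
    congr 1
    ring

lemma Vfun_conjMap (hUf : ∀ x : Omega d, U x = f (fun i => x (((i : ℕ) : ℤ) + 1)))
    (n m : ℕ) (x z : Omega d) :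
    Vfun d U z (conjMap d n m x z) =
      ∑ k ∈ Finset.Ico (-(n : ℤ) - r) m,
        (U (tauZ d k z) - U (tauZ d k (conjMap d n m x z))) := by
  refine tsum_eq_sum fun k hk => ?_
  rw [sub_eq_zero]
  refine apply_tauZ_congr hUf fun j h1 h2 => ?_
  rw [conjMap, if_neg]
  simp only [Finset.mem_Ico] at hk
  omega

lemma abs_Vfun_conjMap_sub_le (hr : 1 ≤ r)
    (hUf : ∀ x : Omega d, U x = f (fun i => x (((i : ℕ) : ℤ) + 1)))
    {M : ℝ} (hM : ∀ x, |U x| ≤ M) (n m : ℕ) (x c z : Omega d) (hz : z ∈ cyl d n m c) :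
    |Vfun d U z (conjMap d n m x z) -
      (birkhoff d U (n + m + 1) (tauZ d (-(n : ℤ) - 1) c) -
        birkhoff d U (n + m + 1) (tauZ d (-(n : ℤ) - 1) x))| ≤ 2 * r * (4 * M) := by
  have hM0 : 0 ≤ M := (abs_nonneg _).trans (hM x)
  have hS : ∀ y : Omega d, birkhoff d U (n + m + 1) (tauZ d (-(n : ℤ) - 1) y) =
      ∑ k ∈ Finset.Ico (-(n : ℤ) - r) m,
        if -(n : ℤ) - 1 ≤ k then U (tauZ d k y) else 0 := by
    intro y
    rw [birkhoff_tauZ, ← Finset.sum_filter]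
    congr 1
    ext k
    simp only [Finset.mem_Ico, Finset.mem_filter]
    push_cast
    omega
  rw [hS, hS, Vfun_conjMap hUf, ← Finset.sum_sub_distrib, ← Finset.sum_sub_distrib]
  refine (Finset.abs_sum_le_sum_abs _ _).trans ?_
  set T : Finset ℤ := Finset.Ico (-(n : ℤ) - r) (-(n : ℤ) - 1) ∪ Finset.Ico ((m : ℤ) - r + 1) m
    with hT
  have hcard : (T.card : ℝ) ≤ 2 * r := by
    have : T.card ≤ 2 * r := by
      refine (Finset.card_union_le _ _).trans ?_
      simp only [Int.card_Ico]
      omega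
    exact_mod_cast this
  have hpt : ∀ k ∈ Finset.Ico (-(n : ℤ) - r) (m : ℤ),
      |U (tauZ d k z) - U (tauZ d k (conjMap d n m x z)) -
        ((if -(n : ℤ) - 1 ≤ k then U (tauZ d k c) else 0) -
          if -(n : ℤ) - 1 ≤ k then U (tauZ d k x) else 0)| ≤ if k ∈ T then 4 * M else 0 := by
    intro k hk
    simp only [Finset.mem_Ico] at hk
    split_ifs with h1 h2 h2
    · have e1 := abs_le.mp (hM (tauZ d k z))
      have e2 := abs_le.mp (hM (tauZ d k (conjMap d n m x z)))
      have e3 := abs_le.mp (hM (tauZ d k c))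
      have e4 := abs_le.mp (hM (tauZ d k x))
      rw [abs_le]
      constructor <;> linarith
    · simp only [hT, Finset.mem_union, Finset.mem_Ico] at h2
      have e1 : U (tauZ d k z) = U (tauZ d k c) :=
        apply_tauZ_congr hUf fun j _ _ => hz j (by omega) (by omega)
      have e2 : U (tauZ d k (conjMap d n m x z)) = U (tauZ d k x) :=
        apply_tauZ_congr hUf fun j _ _ => by rw [conjMap, if_pos (by omega)]
      rw [e1, e2]
      simp
    · have e1 := abs_le.mp (hM (tauZ d k z))
      have e2 := abs_le.mp (hM (tauZ d k (conjMap d n m x z)))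
      rw [abs_le]
      constructor <;> linarith
    · simp only [hT, Finset.mem_union, Finset.mem_Ico] at h2
      omega
  refine (Finset.sum_le_sum hpt).trans ?_
  rw [← Finset.sum_filter, Finset.sum_const, nsmul_eq_mul]
  have hle : (((Finset.Ico (-(n : ℤ) - r) (m : ℤ)).filter (· ∈ T)).card : ℝ) ≤ T.card := by
    exact_mod_cast Finset.card_le_card fun k hk => (Finset.mem_filter.mp hk).2
  exact mul_le_mul_of_nonneg_right (hle.trans hcard) (by positivity)

lemma measurable_of_dependsOn_window
    (hUf : ∀ x : Omega d, U x = f (fun i => x (((i : ℕ) : ℤ) + 1))) : Measurable U := by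
  have : U = f ∘ fun (x : Omega d) (i : Fin r) => x (((i : ℕ) : ℤ) + 1) := funext hUf
  rw [this]
  exact (measurable_of_finite f).comp (measurable_pi_lambda _ fun i => measurable_pi_apply _)

lemma measurable_tauZ (k : ℤ) : Measurable (tauZ d k) :=
  measurable_pi_lambda _ fun _ => measurable_pi_apply _

lemma measurable_conjMap (n m : ℕ) (b : ℤ → Fin d) : Measurable (conjMap d n m b) := by
  refine measurable_pi_lambda _ fun j => ?_
  simp only [conjMap]
  split_ifs
  · exact measurable_const
  · exact measurable_pi_apply j

lemma measurableSet_cyl (n m : ℕ) (a : ℤ → Fin d) : MeasurableSet (cyl d n m a) := by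
  simp only [cyl, Set.ofPred_forall]
  exact MeasurableSet.iInter fun j => MeasurableSet.iInter fun _ => MeasurableSet.iInter fun _ =>
    measurableSet_eq_fun (measurable_pi_apply j) measurable_const

/-- Uniform lower bound for the mass of two-sided cylinders: only the lower quasi-Gibbs inequality
applied to `f = 1` is used. -/
lemma exp_birkhoff_mul_le_measureReal_cyl (hr : 1 ≤ r)
    (hUf : ∀ x : Omega d, U x = f (fun i => x (((i : ℕ) : ℤ) + 1)))
    (hnorm : Normalized d U) {M : ℝ} (hM : ∀ x, |U x| ≤ M)
    (α : Measure (Omega d)) [IsProbabilityMeasure α] {d₁ : ℝ} (hd₁ : 0 < d₁) (n m : ℕ)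
    (x : Omega d)
    (h : ∀ c : ℤ → Fin d,
      d₁ * ∫ z in cyl d n m c, Real.exp (-(Vfun d U z (conjMap d n m x z))) ∂α
        ≤ α.real (cyl d n m x)) :
    d₁ * Real.exp (-(2 * r * (4 * M))) *
      Real.exp (birkhoff d U (n + m + 1) (tauZ d (-(n : ℤ) - 1) x)) ≤ α.real (cyl d n m x) := by
  set S : Omega d → ℝ := fun y => birkhoff d U (n + m + 1) (tauZ d (-(n : ℤ) - 1) y) with hS
  set C : ℝ := 2 * r * (4 * M) with hC
  have hVmeas : Measurable fun z => Vfun d U z (conjMap d n m x z) := by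
    simp only [Vfun_conjMap hUf]
    have hU := measurable_of_dependsOn_window hUf
    exact Finset.measurable_fun_sum _ fun k _ => (hU.comp (measurable_tauZ k)).sub
      (hU.comp ((measurable_tauZ k).comp (measurable_conjMap n m x)))
  have hcyl : ∀ c : Omega d, d₁ * Real.exp (-C) * Real.exp (S x) * α.real (cyl d n m c) ≤
      Real.exp (S c) * α.real (cyl d n m x) := by
    intro c
    have hb : ∀ z ∈ cyl d n m c, |Vfun d U z (conjMap d n m x z) - (S c - S x)| ≤ C :=
      fun z hz => abs_Vfun_conjMap_sub_le hr hUf hM n m x c z hz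
    have hint : IntegrableOn (fun z => Real.exp (-(Vfun d U z (conjMap d n m x z))))
        (cyl d n m c) α := by
      refine Integrable.of_bound (C := Real.exp (S x - S c + C))
        (Real.measurable_exp.comp hVmeas.neg).aestronglyMeasurable ?_
      refine (ae_restrict_iff' (measurableSet_cyl n m c)).mpr (Eventually.of_forall fun z hz => ?_)
      have := abs_le.mp (hb z hz)
      rw [Real.norm_eq_abs, Real.abs_exp, Real.exp_le_exp]
      linarith
    have hlow : Real.exp (S x - S c - C) * α.real (cyl d n m c) ≤
        ∫ z in cyl d n m c, Real.exp (-(Vfun d U z (conjMap d n m x z))) ∂α := by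
      have := setIntegral_mono_on (integrableOn_const (C := Real.exp (S x - S c - C))
        (measure_ne_top α _)) hint (measurableSet_cyl n m c) fun z hz => by
          have := abs_le.mp (hb z hz)
          rw [Real.exp_le_exp]
          linarith
      rwa [setIntegral_const, smul_eq_mul, mul_comm] at this
    calc d₁ * Real.exp (-C) * Real.exp (S x) * α.real (cyl d n m c)
        = Real.exp (S c) * (d₁ * (Real.exp (S x - S c - C) * α.real (cyl d n m c))) := by
          have : Real.exp (-C) * Real.exp (S x) = Real.exp (S c) * Real.exp (S x - S c - C) := by
            rw [← Real.exp_add, ← Real.exp_add]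
            congr 1
            ring
          linear_combination d₁ * α.real (cyl d n m c) * this
      _ ≤ Real.exp (S c) * α.real (cyl d n m x) := by
          gcongr
          exact (mul_le_mul_of_nonneg_left hlow hd₁.le).trans (h c)
  set c : (Fin (n + m + 1) → Fin d) → Omega d :=
    fun w => tauZ d ((n : ℤ) + 1) (prependWord d (n + m + 1) w x) with hc
  have hSc : ∑ w, Real.exp (S (c w)) = 1 := by
    rw [← sum_exp_birkhoff_prependWord hUf hnorm (n + m + 1) x]
    refine Finset.sum_congr rfl fun w _ => ?_
    simp only [hS, hc]
    congr 2
    funext j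
    simp only [tauZ]
    congr 1
    ring
  have hcover : (1 : ℝ) ≤ ∑ w, α.real (cyl d n m (c w)) := by
    have huniv : (Set.univ : Set (Omega d)) = ⋃ w, cyl d n m (c w) := by
      refine (Set.eq_univ_of_forall fun z => Set.mem_iUnion.mpr ?_).symm
      obtain ⟨w, hw⟩ := exists_prependWord_eq d x (n + m + 1) (tauZ d (-(n : ℤ) - 1) z)
      refine ⟨w, fun j h1 h2 => ?_⟩
      simp only [hc, tauZ]
      rw [hw _ (by omega) (by push_cast; omega), tauZ]
      congr 1
      ring
    rw [← probReal_univ (μ := α), huniv]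
    exact measureReal_iUnion_fintype_le _
  calc d₁ * Real.exp (-C) * Real.exp (S x)
      ≤ d₁ * Real.exp (-C) * Real.exp (S x) * ∑ w, α.real (cyl d n m (c w)) :=
        le_mul_of_one_le_right (by positivity) hcover
    _ ≤ ∑ w, Real.exp (S (c w)) * α.real (cyl d n m x) := by
        rw [Finset.mul_sum]
        exact Finset.sum_le_sum fun w _ => hcyl (c w)
    _ = α.real (cyl d n m x) := by rw [← Finset.sum_mul, hSc, one_mul]

end FiniteRange

/-- for a normalized `U(x) = f(x₁,…,x_r)` and a quasi-C*-Gibbs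
`α`, there is `c₁ > 0` with
`c₁ ≤ exp(-∑_{k<s} U(τ^k x)) · α(cylinder)` for every future cylinder; in
particular every cylinder has positive measure. -/
theorem quasiGibbs_lower_bowen (d : ℕ) (hd : 2 ≤ d) (r : ℕ) (hr : 1 ≤ r)
    (f : (Fin r → Fin d) → ℝ) (U : Omega d → ℝ)
    (hUf : ∀ x : Omega d, U x = f (fun i => x (((i : ℕ) : ℤ) + 1)))
    (hnorm : Normalized d U)
    (α : Measure (Omega d)) (hα : IsProbabilityMeasure α)
    (h : QuasiCStarGibbs d U α) :
    ∃ c₁ : ℝ, 0 < c₁ ∧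
      (∀ s : ℕ, 1 ≤ s → ∀ (a : ℕ → Fin d) (x : Omega d),
        (∀ k : ℕ, 1 ≤ k → k ≤ s → x (k : ℤ) = a k) →
        c₁ ≤ Real.exp (-(birkhoff d U s x)) * (α (futureCyl d s a)).toReal) ∧
      (∀ s : ℕ, 1 ≤ s → ∀ a : ℕ → Fin d, 0 < α (futureCyl d s a)) := by
  obtain ⟨d₁, d₂, hd₁, -, hq⟩ := h
  obtain ⟨M, hM⟩ : ∃ M, ∀ x, |U x| ≤ M := by
    obtain ⟨M, hM⟩ := (Set.finite_range fun w => |f w|).bddAbove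
    exact ⟨M, fun x => by rw [hUf]; exact hM ⟨_, rfl⟩⟩
  set C : ℝ := 2 * r * (4 * M) with hC
  have hlower : ∀ s : ℕ, 1 ≤ s → ∀ (a : ℕ → Fin d) (x : Omega d),
      (∀ k : ℕ, 1 ≤ k → k ≤ s → x (k : ℤ) = a k) →
      d₁ * Real.exp (-C) * Real.exp (-(2 * M)) ≤
        Real.exp (-(birkhoff d U s x)) * (α (futureCyl d s a)).toReal := by
    intro s hs a x hx
    have hcyl := exp_birkhoff_mul_le_measureReal_cyl hr hUf hnorm hM α hd₁ 1 s x fun c => by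
      simpa using (hq 1 s le_rfl hs c x (fun _ => 1) continuous_const fun _ => zero_le_one).1
    have hmono : α.real (cyl d 1 s x) ≤ α.real (futureCyl d s a) :=
      measureReal_mono fun z hz k h1 h2 =>
        (hz k (by push_cast; omega) (by omega)).trans (hx k h1 h2)
    have hbirk : birkhoff d U s x - 2 * M ≤
        birkhoff d U (1 + s + 1) (tauZ d (-((1 : ℕ) : ℤ) - 1) x) := by
      rw [show 1 + s + 1 = s + 2 by ring, birkhoff, birkhoff, Finset.sum_range_succ',
        Finset.sum_range_succ']
      have hsum : ∀ k ∈ Finset.range s, U (tauZ d ((k + 1 + 1 : ℕ) : ℤ)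
          (tauZ d (-((1 : ℕ) : ℤ) - 1) x)) = U (tauZ d k x) := by
        intro k _
        congr 1
        funext j
        simp only [tauZ]
        congr 1
        push_cast
        ring
      rw [Finset.sum_congr rfl hsum]
      have h1 := abs_le.mp (hM (tauZ d ((0 + 1 : ℕ) : ℤ) (tauZ d (-((1 : ℕ) : ℤ) - 1) x)))
      have h2 := abs_le.mp (hM (tauZ d ((0 : ℕ) : ℤ) (tauZ d (-((1 : ℕ) : ℤ) - 1) x)))
      linarith
    calc d₁ * Real.exp (-C) * Real.exp (-(2 * M))
        = Real.exp (-(birkhoff d U s x)) *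
            (d₁ * Real.exp (-C) * Real.exp (birkhoff d U s x - 2 * M)) := by
          have : Real.exp (-(2 * M)) =
              Real.exp (-(birkhoff d U s x)) * Real.exp (birkhoff d U s x - 2 * M) := by
            rw [← Real.exp_add]
            congr 1
            ring
          rw [this]
          ring
      _ ≤ Real.exp (-(birkhoff d U s x)) * α.real (futureCyl d s a) := by
          gcongr
          refine le_trans ?_ (hcyl.trans hmono)
          gcongr
  refine ⟨_, by positivity, hlower, fun s hs a => ?_⟩
  have hpos := hlower s hs a (fun k => a k.toNat) fun k _ _ => by simp
  have h0 : 0 < d₁ * Real.exp (-C) * Real.exp (-(2 * M)) := by positivity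
  rw [pos_iff_ne_zero]
  intro hzero
  rw [hzero] at hpos
  simp only [ENNReal.toReal_zero, mul_zero] at hpos
  linarith
end
end
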